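/- Let g be a simple Lie 2-algebra over F with toral rank MT(g) = 3 and standard maximal torus t (so the Cartan subalgebra h = c_g(t) is triangulable). Then the set of t-roots Δ consists of all seven nonzero elements of t*; equivalently, there is no simple Lie 2-algebra with triangulable Cartan subalgebra, toral rank 3, and at most six t-roots. -/

import Mathlib

/-- A 2-map on a Lie algebra over the field `F` (char 2 version of a restricted structure):
`(c • x)^[2] = c^2 • x^[2]`, `ad (x^[2]) = (ad x) ∘ (ad x)` and
`(x+y)^[2] = x^[2] + y^[2] + [x,y]`. -/
structure IsTwoMap (F : Type*) [Field F] {g : Type*} [LieRing g] [LieAlgebra F g]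
    (p : g → g) : Prop where
  smul_pow : ∀ (c : F) (x : g), p (c • x) = (c ^ 2) • p x
  ad_pow : ∀ x y : g, ⁅p x, y⁆ = ⁅x, ⁅x, y⁆⁆
  add_pow : ∀ x y : g, p (x + y) = p x + p y + ⁅x, y⁆

/-- An element is 2-nilpotent if some iterate of the 2-map annihilates it. -/
def IsTwoNilpotent {g : Type*} [Zero g] (p : g → g) (x : g) : Prop :=
  ∃ k : ℕ, p^[k] x = 0

/-- A torus of a Lie 2-algebra: a Lie subalgebra closed under the 2-map on which the
2-map is invertible (bijective). -/
def IsTorus (F : Type*) [Field F] {g : Type*} [LieRing g] [LieAlgebra F g]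
    (p : g → g) (t : LieSubalgebra F g) : Prop :=
  (∀ x ∈ t, p x ∈ t) ∧ Set.BijOn p (t : Set g) (t : Set g)

/-- A maximal torus of a Lie 2-algebra. -/
def IsMaxTorus (F : Type*) [Field F] {g : Type*} [LieRing g] [LieAlgebra F g]
    (p : g → g) (t : LieSubalgebra F g) : Prop :=
  IsTorus F p t ∧ ∀ s : LieSubalgebra F g, IsTorus F p s → t ≤ s → s = t

/-- The weight (root) space of a linear functional `lam` on a torus `t`:
`g_lam = {v | [x, v] = lam x • v for all x ∈ t}`. -/
def rootSpace {F : Type*} [Field F] {g : Type*} [LieRing g] [LieAlgebra F g]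
    (t : LieSubalgebra F g) (lam : Module.Dual F t) : Submodule F g where
  carrier := {v | ∀ x : t, ⁅(x : g), v⁆ = lam x • v}
  add_mem' := by
    intro a b ha hb x
    rw [lie_add, ha x, hb x, smul_add]
  zero_mem' := by
    intro x
    rw [lie_zero, smul_zero]
  smul_mem' := by
    intro c v hv x
    rw [lie_smul, hv x, smul_comm]

/-- The set of `t`-roots: nonzero functionals with nonzero root space. -/
def rootSet {F : Type*} [Field F] {g : Type*} [LieRing g] [LieAlgebra F g]
    (t : LieSubalgebra F g) : Set (Module.Dual F t) :=
  {lam | lam ≠ 0 ∧ rootSpace t lam ≠ ⊥}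

/-- The subspace `N(σ, δ) = {x ∈ g_σ : [x, g_σ] ⊆ n and [[x, g_δ], g_{σ+δ}] ⊆ n}`,
given as `Nspace n g_σ g_δ g_{σ+δ}`. -/
def Nspace {F : Type*} [Field F] {g : Type*} [LieRing g] [LieAlgebra F g]
    (n gs gd gsd : Submodule F g) : Submodule F g where
  carrier := {x | x ∈ gs ∧ (∀ y ∈ gs, ⁅x, y⁆ ∈ n) ∧ ∀ z ∈ gd, ∀ w ∈ gsd, ⁅⁅x, z⁆, w⁆ ∈ n}
  add_mem' := by
    intro a b ha hb
    obtain ⟨ha1, ha2, ha3⟩ := ha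
    obtain ⟨hb1, hb2, hb3⟩ := hb
    refine ⟨gs.add_mem ha1 hb1, fun y hy => ?_, fun z hz w hw => ?_⟩
    · rw [add_lie]
      exact n.add_mem (ha2 y hy) (hb2 y hy)
    · rw [add_lie, add_lie]
      exact n.add_mem (ha3 z hz w hw) (hb3 z hz w hw)
  zero_mem' := by
    refine ⟨gs.zero_mem, fun y hy => ?_, fun z hz w hw => ?_⟩
    · rw [zero_lie]; exact n.zero_mem
    · rw [zero_lie, zero_lie]; exact n.zero_mem
  smul_mem' := by
    intro c x hx
    obtain ⟨h1, h2, h3⟩ := hx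
    refine ⟨gs.smul_mem c h1, fun y hy => ?_, fun z hz w hw => ?_⟩
    · rw [smul_lie]; exact n.smul_mem c (h2 y hy)
    · rw [smul_lie, smul_lie]; exact n.smul_mem c (h3 z hz w hw)

set_option synthInstance.maxSize 100000 in
theorem eq_of_linearIndependent_triple :
    ∀ l m : ZMod 2 × ZMod 2 × ZMod 2, l ≠ 0 → m ≠ 0 → m ≠ l →
    ∀ d, d ≠ 0 → d ≠ l → d ≠ m → d ≠ m + l →
    ∀ e, e = 0 ∨ e = l ∨ e = m ∨ e = m + l ∨ e = d ∨ e = d + l ∨ e = m + d ∨ e = m + d + l := by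
  decide +kernel

theorem exists_orthogonal_pair : ∀ l m : ZMod 2 × ZMod 2 × ZMod 2,
    ∃ s : ZMod 2 × ZMod 2 × ZMod 2, s ≠ 0 ∧
      l.1 * s.1 + l.2.1 * s.2.1 + l.2.2 * s.2.2 = 0 ∧
      m.1 * s.1 + m.2.1 * s.2.1 + m.2.2 * s.2.2 = 0 := by
  decide +kernel

/-- If a spanning set `D` of `F₂³` containing `0` is not everything, some nonzero `f` lies, for
each nonzero `l ∈ D`, in the span of those `m ∈ D` with `m = l` or `l + m ∉ D`. -/
theorem exists_annihilated_weight (D : ZMod 2 × ZMod 2 × ZMod 2 → Prop) (h0 : D 0)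
    (hspan : ∀ s : ZMod 2 × ZMod 2 × ZMod 2, s ≠ 0 →
      ∃ e, D e ∧ e.1 * s.1 + e.2.1 * s.2.1 + e.2.2 * s.2.2 ≠ 0)
    {d : ZMod 2 × ZMod 2 × ZMod 2} (hd : ¬D d) :
    ∃ f : ZMod 2 × ZMod 2 × ZMod 2, f ≠ 0 ∧ ∀ l, l ≠ 0 → D l →
      ∃ a b, (D a ∧ (l = a ∨ ¬D (l + a))) ∧ (b = 0 ∨ D b ∧ (l = b ∨ ¬D (l + b))) ∧
        a + b = f := by
  have hc : ∀ x y : ZMod 2 × ZMod 2 × ZMod 2, x + (x + y) = y := by decide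
  have hcc : ∀ x y : ZMod 2 × ZMod 2 × ZMod 2, x + y + y = x := by decide
  have hdbl : ∀ y : ZMod 2 × ZMod 2 × ZMod 2, y + y = 0 := by decide
  have hne0 : ∀ {x}, ¬D x → x ≠ 0 := fun hx h => hx (h ▸ h0)
  by_cases h1 : ∀ l, l ≠ 0 → D l → D (l + d)
  · refine ⟨d, hne0 hd, fun l hl hDl => ⟨l, l + d, ⟨hDl, .inl rfl⟩, ?_, hc l d⟩⟩
    exact .inr ⟨h1 l hl hDl, .inr (by rwa [hc])⟩
  push Not at h1
  obtain ⟨l, hl, hDl, hld⟩ := h1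
  by_cases h2 : ∀ m, m ≠ 0 → m ≠ l → D m → D (m + l) → D (m + d) ∧ D (m + (l + d))
  · refine ⟨l, hl, fun m hm hDm => ?_⟩
    by_cases hml : m = l
    · exact ⟨l, 0, ⟨hDl, .inl hml⟩, .inl rfl, add_zero l⟩
    · by_cases hDml : D (m + l)
      · obtain ⟨ha, hb⟩ := h2 m hm hml hDm hDml
        refine ⟨m + d, m + (l + d), ⟨ha, .inr (by rwa [hc])⟩,
          .inr ⟨hb, .inr (by rwa [hc])⟩, ?_⟩
        rw [add_add_add_comm, hdbl, zero_add, add_comm l, hc]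
      · exact ⟨l, 0, ⟨hDl, .inr hDml⟩, .inl rfl, add_zero l⟩
  push Not at h2
  obtain ⟨m, hm, hml, hDm, hDml, hmd⟩ := h2
  obtain ⟨d, hd, hdl, hdm⟩ : ∃ d, ¬D d ∧ ¬D (d + l) ∧ ¬D (m + d) := by
    by_cases h : D (m + d)
    · exact ⟨l + d, hld, by rwa [add_comm l d, hcc], hmd h⟩
    · exact ⟨d, hd, by rwa [add_comm], h⟩
  have hall := eq_of_linearIndependent_triple l m hl hm hml d (hne0 hd) (fun h => hd (h ▸ hDl))
    (fun h => hd (h ▸ hDm)) (fun h => hd (h ▸ hDml))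
  obtain ⟨s, hs0, hsl, hsm⟩ := exists_orthogonal_pair l m
  obtain ⟨e, hDe, hes⟩ := hspan s hs0
  have hk : e = m + d + l := by
    rcases hall e with rfl | rfl | rfl | rfl | rfl | rfl | rfl | rfl
    · simp at hes
    · exact absurd hsl hes
    · exact absurd hsm hes
    · refine absurd ?_ hes
      simp only [Prod.fst_add, Prod.snd_add]
      linear_combination hsl + hsm
    all_goals first | contradiction | rfl
  refine ⟨e, ?_, fun x hx hDx => ⟨e, 0, ⟨hDe, ?_⟩, .inl rfl, add_zero e⟩⟩
  · rintro rfl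
    simp at hes
  · subst hk
    rcases hall x with rfl | rfl | rfl | rfl | rfl | rfl | rfl | rfl
    · exact absurd rfl hx
    · exact .inr (by rwa [add_comm, hcc])
    · exact .inr (by rwa [add_assoc, hc])
    · exact .inr (by rwa [add_assoc m d, add_add_add_comm, add_comm d, hc, hdbl, zero_add])
    all_goals first | contradiction | exact .inl rfl

section Weights

variable {F : Type*} [Field F] {g : Type*} [LieRing g] [LieAlgebra F g]

theorem lie_mem_rootSpace {t : LieSubalgebra F g} {a b : Module.Dual F t} {x y : g}
    (hx : x ∈ rootSpace t a) (hy : y ∈ rootSpace t b) : ⁅x, y⁆ ∈ rootSpace t (a + b) := by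
  intro s
  rw [leibniz_lie, hx s, hy s, smul_lie, lie_smul, LinearMap.add_apply, add_smul]

theorem IsTwoMap.mem_rootSpace_zero {p : g → g} (hp : IsTwoMap F p) {t : LieSubalgebra F g}
    {a : Module.Dual F t} {x : g} (hx : x ∈ rootSpace t a) : p x ∈ rootSpace t 0 := by
  intro s
  rw [← lie_skew, hp.ad_pow, ← lie_skew x (s : g), hx s]
  simp

theorem IsTwoMap.iterate_lie {p : g → g} (hp : IsTwoMap F p) {x z : g} {c : F}
    (h : ⁅x, z⁆ = c • z) (k : ℕ) : ⁅p^[k] x, z⁆ = c ^ 2 ^ k • z := by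
  induction k with
  | zero => simpa using h
  | succ k ih =>
    rw [Function.iterate_succ_apply', hp.ad_pow, ih, lie_smul, ih, smul_smul, ← pow_add]
    congr 2
    ring

/-- A toral plus a nilpotent element killing a nonzero weight vector lies in the kernel of
the weight. -/
theorem IsTwoMap.weight_eq_zero {p : g → g} (hp : IsTwoMap F p) {t : LieSubalgebra F g}
    {m : Module.Dual F t} {s : t} {v z : g} (hv : IsTwoNilpotent p v)
    (hz : z ∈ rootSpace t m) (hz0 : z ≠ 0) (h : ⁅(s : g) + v, z⁆ = 0) : m s = 0 := by
  obtain ⟨k, hk⟩ := hv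
  rw [add_lie, hz s] at h
  have h1 : ⁅v, z⁆ = (-m s) • z := by rw [neg_smul]; exact eq_neg_of_add_eq_zero_right h
  have h2 := hp.iterate_lie h1 k
  rw [hk, zero_lie] at h2
  have h3 := (smul_eq_zero.1 h2.symm).resolve_right hz0
  simpa using eq_zero_of_pow_eq_zero h3

/-- The eigenprojection of an idempotent endomorphism for the eigenvalue `a`. -/
def eigenProj (E : Module.End F g) (a : ZMod 2) : Module.End F g :=
  if a = 0 then 1 - E else E

theorem sum_eigenProj (E : Module.End F g) : ∑ a, eigenProj E a = 1 := by
  have : (Finset.univ : Finset (ZMod 2)) = {0, 1} := by decide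
  rw [this, Finset.sum_pair (by decide)]
  simp [eigenProj]

theorem mul_eigenProj [CharP F 2] {E : Module.End F g} (hE : E * E = E) (a : ZMod 2) :
    E * eigenProj E a = (ZMod.castHom (dvd_refl 2) F a) • eigenProj E a := by
  obtain rfl | rfl : a = 0 ∨ a = 1 := by revert a; decide
  · simp [eigenProj, mul_sub, hE]
  · simp only [eigenProj, one_ne_zero, if_false, hE, map_one, one_smul]

theorem commute_eigenProj {E E' : Module.End F g} (h : Commute E E') (a : ZMod 2) :
    Commute E (eigenProj E' a) := by
  unfold eigenProj
  split_ifs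
  · exact (Commute.one_right E).sub_right h
  · exact h

/-- The joint eigenprojection of three idempotent endomorphisms. -/
def jointProj (E₁ E₂ E₃ : Module.End F g) (e : ZMod 2 × ZMod 2 × ZMod 2) : Module.End F g :=
  eigenProj E₁ e.1 * (eigenProj E₂ e.2.1 * eigenProj E₃ e.2.2)

theorem sum_jointProj (E₁ E₂ E₃ : Module.End F g) : ∑ e, jointProj E₁ E₂ E₃ e = 1 := by
  simp only [jointProj, Fintype.sum_prod_type, ← Finset.mul_sum, sum_eigenProj, mul_one]

/-- The functional with `F₂`-coordinates `e` in the system `α, β, γ`. -/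
def weight [CharP F 2] {t : LieSubalgebra F g} (α β γ : Module.Dual F t)
    (e : ZMod 2 × ZMod 2 × ZMod 2) : Module.Dual F t :=
  ZMod.castHom (dvd_refl 2) F e.1 • α + (ZMod.castHom (dvd_refl 2) F e.2.1 • β +
    ZMod.castHom (dvd_refl 2) F e.2.2 • γ)

theorem weight_add [CharP F 2] {t : LieSubalgebra F g} (α β γ : Module.Dual F t)
    (e e' : ZMod 2 × ZMod 2 × ZMod 2) :
    weight α β γ (e + e') = weight α β γ e + weight α β γ e' := by
  simp only [weight, Prod.fst_add, Prod.snd_add, map_add, add_smul]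
  abel

theorem weight_zero [CharP F 2] {t : LieSubalgebra F g} (α β γ : Module.Dual F t) :
    weight α β γ 0 = 0 := by
  simp [weight]

theorem mem_rootSpace_of_span {t : LieSubalgebra F g} {t₁ t₂ t₃ : t}
    (hspan : Submodule.span F ({t₁, t₂, t₃} : Set t) = ⊤) {a : Module.Dual F t} {v : g}
    (h₁ : ⁅(t₁ : g), v⁆ = a t₁ • v) (h₂ : ⁅(t₂ : g), v⁆ = a t₂ • v)
    (h₃ : ⁅(t₃ : g), v⁆ = a t₃ • v) : v ∈ rootSpace t a := by
  intro s
  have hs : s ∈ Submodule.span F ({t₁, t₂, t₃} : Set t) := hspan ▸ Submodule.mem_top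
  induction hs using Submodule.span_induction with
  | mem x hx =>
    rcases hx with rfl | rfl | rfl <;> assumption
  | zero => simp
  | add x y _ _ hx hy => simp [hx, hy, add_smul]
  | smul c x _ hx => simp [hx, mul_smul]

theorem dual_ext_of_span {t : LieSubalgebra F g} {t₁ t₂ t₃ : t}
    (hspan : Submodule.span F ({t₁, t₂, t₃} : Set t) = ⊤) {a b : Module.Dual F t}
    (h₁ : a t₁ = b t₁) (h₂ : a t₂ = b t₂) (h₃ : a t₃ = b t₃) : a = b := by
  refine LinearMap.ext_on hspan ?_
  rintro x (rfl | rfl | rfl) <;> assumption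

/-- A weight takes the value `0` or `1` on a toral element. -/
theorem IsTwoMap.exists_zmod_eq [CharP F 2] {p : g → g} (hp : IsTwoMap F p)
    {t : LieSubalgebra F g} {s : t} (hs : p (s : g) = s) {a : Module.Dual F t}
    (ha : rootSpace t a ≠ ⊥) : ∃ c : ZMod 2, a s = ZMod.castHom (dvd_refl 2) F c := by
  obtain ⟨v, hv, hv0⟩ := Submodule.exists_mem_ne_zero_of_ne_bot ha
  have h := hp.iterate_lie (hv s) 1
  rw [Function.iterate_one, hs, hv s] at h
  have h1 : a s = a s ^ 2 := by simpa using smul_left_injective F hv0 h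
  have h2 : a s * (a s - 1) = 0 := by linear_combination -h1
  rcases mul_eq_zero.1 h2 with h3 | h3
  · exact ⟨0, by rw [h3, map_zero]⟩
  · exact ⟨1, by rw [sub_eq_zero.1 h3, map_one]⟩

theorem central_eq_zero [FiniteDimensional F g] (hdim1 : Module.finrank F g ≠ 1)
    (hsimple : ∀ I : LieIdeal F g, I = ⊥ ∨ I = ⊤) {x : g} (hx : ∀ y : g, ⁅y, x⁆ = 0) :
    x = 0 := by
  by_contra hx0
  let I : LieIdeal F g :=
    { Submodule.span F {x} with
      lie_mem := by
        intro y m hm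
        obtain ⟨c, rfl⟩ := Submodule.mem_span_singleton.1 hm
        rw [lie_smul, hx, smul_zero]
        exact Submodule.zero_mem _ }
  have hxI : x ∈ I := Submodule.mem_span_singleton_self x
  rcases hsimple I with h | h
  · rw [h] at hxI
    exact hx0 ((LieSubmodule.mem_bot x).1 hxI)
  · refine hdim1 (finrank_eq_one x hx0 fun w => ?_)
    have hw : w ∈ I := h ▸ LieSubmodule.mem_top w
    exact Submodule.mem_span_singleton.1 hw

/-- A linear form vanishing on all brackets of a simple Lie algebra vanishes. -/
theorem linearMap_eq_zero_of_lie [FiniteDimensional F g] (hdim1 : Module.finrank F g ≠ 1)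
    (hsimple : ∀ I : LieIdeal F g, I = ⊥ ∨ I = ⊤) (φ : g →ₗ[F] F)
    (hφ : ∀ x y : g, φ ⁅x, y⁆ = 0) (x : g) : φ x = 0 := by
  rcases hsimple ⁅(⊤ : LieIdeal F g), (⊤ : LieIdeal F g)⁆ with h | h
  · rw [central_eq_zero hdim1 hsimple (x := x), map_zero]
    intro y
    have : ⁅y, x⁆ ∈ ⁅(⊤ : LieIdeal F g), (⊤ : LieIdeal F g)⁆ :=
      LieSubmodule.lie_mem_lie (LieSubmodule.mem_top y) (LieSubmodule.mem_top x)
    rw [h] at this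
    exact (LieSubmodule.mem_bot _).1 this
  · have hx : x ∈ (⁅(⊤ : LieIdeal F g), (⊤ : LieIdeal F g)⁆ : LieIdeal F g).toSubmodule := by
      rw [h]; exact Submodule.mem_top
    rw [LieSubmodule.lieIdeal_oper_eq_linear_span'] at hx
    induction hx using Submodule.span_induction with
    | mem x hx => obtain ⟨y, _, z, _, rfl⟩ := hx; exact hφ y z
    | zero => exact map_zero φ
    | add x y _ _ hx hy => rw [map_add, hx, hy, add_zero]
    | smul c x _ hx => rw [map_smul, hx, smul_zero]

theorem commute_ad {x y : g} (h : ⁅x, y⁆ = 0) :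
    Commute (LieAlgebra.ad F g x) (LieAlgebra.ad F g y) := by
  refine LinearMap.ext fun v => ?_
  simp only [Module.End.mul_apply, LieAlgebra.ad_apply]
  rw [leibniz_lie, h, zero_lie, zero_add]

theorem IsTwoMap.ad_mul_ad {p : g → g} (hp : IsTwoMap F p) {x : g} (hx : p x = x) :
    LieAlgebra.ad F g x * LieAlgebra.ad F g x = LieAlgebra.ad F g x := by
  refine LinearMap.ext fun v => ?_
  simp only [Module.End.mul_apply, LieAlgebra.ad_apply]
  rw [← hp.ad_pow, hx]

theorem jointProj_mem_rootSpace [CharP F 2] {p : g → g} (hp : IsTwoMap F p)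
    {t : LieSubalgebra F g} (ht : ∀ x y : t, ⁅(x : g), (y : g)⁆ = 0) {t₁ t₂ t₃ : t}
    (htor1 : p (t₁ : g) = (t₁ : g)) (htor2 : p (t₂ : g) = (t₂ : g))
    (htor3 : p (t₃ : g) = (t₃ : g))
    (hspan : Submodule.span F ({t₁, t₂, t₃} : Set t) = ⊤)
    {α β γ : Module.Dual F t}
    (hα : α t₁ = 1 ∧ α t₂ = 0 ∧ α t₃ = 0)
    (hβ : β t₁ = 0 ∧ β t₂ = 1 ∧ β t₃ = 0)
    (hγ : γ t₁ = 0 ∧ γ t₂ = 0 ∧ γ t₃ = 1) (e : ZMod 2 × ZMod 2 × ZMod 2) (v : g) :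
    jointProj (LieAlgebra.ad F g (t₁ : g)) (LieAlgebra.ad F g (t₂ : g))
      (LieAlgebra.ad F g (t₃ : g)) e v ∈ rootSpace t (weight α β γ e) := by
  set E₁ := LieAlgebra.ad F g (t₁ : g) with hE₁
  set E₂ := LieAlgebra.ad F g (t₂ : g) with hE₂
  set E₃ := LieAlgebra.ad F g (t₃ : g) with hE₃
  have c12 : Commute E₁ E₂ := commute_ad (ht t₁ t₂)
  have c13 : Commute E₁ E₃ := commute_ad (ht t₁ t₃)
  have c23 : Commute E₂ E₃ := commute_ad (ht t₂ t₃)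
  have k₁ : E₁ * jointProj E₁ E₂ E₃ e =
      ZMod.castHom (dvd_refl 2) F e.1 • jointProj E₁ E₂ E₃ e := by
    rw [jointProj, ← mul_assoc, mul_eigenProj (hp.ad_mul_ad htor1), smul_mul_assoc]
  have k₂ : E₂ * jointProj E₁ E₂ E₃ e =
      ZMod.castHom (dvd_refl 2) F e.2.1 • jointProj E₁ E₂ E₃ e := by
    rw [jointProj, (commute_eigenProj c12.symm _).left_comm, ← mul_assoc E₂,
      mul_eigenProj (hp.ad_mul_ad htor2), smul_mul_assoc, mul_smul_comm]
  have k₃ : E₃ * jointProj E₁ E₂ E₃ e =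
      ZMod.castHom (dvd_refl 2) F e.2.2 • jointProj E₁ E₂ E₃ e := by
    rw [jointProj, (commute_eigenProj c13.symm _).left_comm,
      (commute_eigenProj c23.symm _).left_comm,
      mul_eigenProj (hp.ad_mul_ad htor3), mul_smul_comm, mul_smul_comm]
  obtain ⟨hα1, hα2, hα3⟩ := hα
  obtain ⟨hβ1, hβ2, hβ3⟩ := hβ
  obtain ⟨hγ1, hγ2, hγ3⟩ := hγ
  refine mem_rootSpace_of_span hspan ?_ ?_ ?_
  · simpa [weight, hα1, hβ1, hγ1, hE₁] using LinearMap.congr_fun k₁ v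
  · simpa [weight, hα2, hβ2, hγ2, hE₂] using LinearMap.congr_fun k₂ v
  · simpa [weight, hα3, hβ3, hγ3, hE₃] using LinearMap.congr_fun k₃ v

theorem jointProj_zero_of_mem [CharP F 2] {t : LieSubalgebra F g} (t₁ t₂ t₃ : t)
    {α β γ : Module.Dual F t}
    (hα : α t₁ = 1 ∧ α t₂ = 0 ∧ α t₃ = 0)
    (hβ : β t₁ = 0 ∧ β t₂ = 1 ∧ β t₃ = 0)
    (hγ : γ t₁ = 0 ∧ γ t₂ = 0 ∧ γ t₃ = 1) {e : ZMod 2 × ZMod 2 × ZMod 2} {v : g}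
    (hv : v ∈ rootSpace t (weight α β γ e)) :
    jointProj (LieAlgebra.ad F g (t₁ : g)) (LieAlgebra.ad F g (t₂ : g))
      (LieAlgebra.ad F g (t₃ : g)) 0 v = if e = 0 then v else 0 := by
  obtain ⟨hα1, hα2, hα3⟩ := hα
  obtain ⟨hβ1, hβ2, hβ3⟩ := hβ
  obtain ⟨hγ1, hγ2, hγ3⟩ := hγ
  obtain ⟨a, b, c⟩ := e
  have h₁ := hv t₁
  have h₂ := hv t₂
  have h₃ := hv t₃
  simp only [weight, LinearMap.add_apply, LinearMap.smul_apply, hα1, hα2, hα3, hβ1, hβ2, hβ3,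
    hγ1, hγ2, hγ3, smul_eq_mul, mul_zero, mul_one, add_zero, zero_add] at h₁ h₂ h₃
  simp only [jointProj, eigenProj, Prod.fst_zero, Prod.snd_zero, if_true, Module.End.mul_apply,
    LinearMap.sub_apply, Module.End.one_apply, LieAlgebra.ad_apply, h₁, h₂, h₃, lie_sub, lie_smul]
  have h01 : ∀ a : ZMod 2, a = 0 ∨ a = 1 := by decide
  rcases h01 a with rfl | rfl <;> rcases h01 b with rfl | rfl <;>
    rcases h01 c with rfl | rfl <;> simp

theorem weight_apply [CharP F 2] {t : LieSubalgebra F g} {t₁ t₂ t₃ : t}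
    {α β γ : Module.Dual F t}
    (hα : α t₁ = 1 ∧ α t₂ = 0 ∧ α t₃ = 0)
    (hβ : β t₁ = 0 ∧ β t₂ = 1 ∧ β t₃ = 0)
    (hγ : γ t₁ = 0 ∧ γ t₂ = 0 ∧ γ t₃ = 1) (e : ZMod 2 × ZMod 2 × ZMod 2) :
    weight α β γ e t₁ = ZMod.castHom (dvd_refl 2) F e.1 ∧
      weight α β γ e t₂ = ZMod.castHom (dvd_refl 2) F e.2.1 ∧
      weight α β γ e t₃ = ZMod.castHom (dvd_refl 2) F e.2.2 := by
  obtain ⟨hα1, hα2, hα3⟩ := hα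
  obtain ⟨hβ1, hβ2, hβ3⟩ := hβ
  obtain ⟨hγ1, hγ2, hγ3⟩ := hγ
  simp [weight, hα1, hα2, hα3, hβ1, hβ2, hβ3, hγ1, hγ2, hγ3]

theorem weight_ne_zero [CharP F 2] {t : LieSubalgebra F g} {t₁ t₂ t₃ : t}
    {α β γ : Module.Dual F t}
    (hα : α t₁ = 1 ∧ α t₂ = 0 ∧ α t₃ = 0)
    (hβ : β t₁ = 0 ∧ β t₂ = 1 ∧ β t₃ = 0)
    (hγ : γ t₁ = 0 ∧ γ t₂ = 0 ∧ γ t₃ = 1) {e : ZMod 2 × ZMod 2 × ZMod 2} (he : e ≠ 0) :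
    weight α β γ e ≠ 0 := by
  intro h
  obtain ⟨h₁, h₂, h₃⟩ := weight_apply hα hβ hγ e
  rw [h, LinearMap.zero_apply] at h₁ h₂ h₃
  exact he (Prod.ext ((map_eq_zero _).1 h₁.symm)
    (Prod.ext ((map_eq_zero _).1 h₂.symm) ((map_eq_zero _).1 h₃.symm)))

/-- Every joint weight of the toral basis occurs in a simple algebra. -/
theorem rootSpace_weight_ne_bot [CharP F 2] [FiniteDimensional F g]
    {p : g → g} (hp : IsTwoMap F p) (hdim1 : Module.finrank F g ≠ 1)
    (hsimple : ∀ I : LieIdeal F g, I = ⊥ ∨ I = ⊤) {t : LieSubalgebra F g} {n : Submodule F g}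
    (hn : ∀ x ∈ n, IsTwoNilpotent p x)
    (hstd : ∀ x ∈ rootSpace t 0, ∀ y ∈ n, ⁅x, y⁆ ∈ n)
    (hdecomp : rootSpace t 0 = t.toSubmodule ⊔ n)
    (hdisj : Disjoint t.toSubmodule n) {t₁ t₂ t₃ : t}
    (htor1 : p (t₁ : g) = (t₁ : g)) (htor2 : p (t₂ : g) = (t₂ : g))
    (htor3 : p (t₃ : g) = (t₃ : g))
    (hspan : Submodule.span F ({t₁, t₂, t₃} : Set t) = ⊤)
    {α β γ : Module.Dual F t}
    (hα : α t₁ = 1 ∧ α t₂ = 0 ∧ α t₃ = 0)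
    (hβ : β t₁ = 0 ∧ β t₂ = 1 ∧ β t₃ = 0)
    (hγ : γ t₁ = 0 ∧ γ t₂ = 0 ∧ γ t₃ = 1) (e₀ : ZMod 2 × ZMod 2 × ZMod 2) :
    rootSpace t (weight α β γ e₀) ≠ ⊥ := by
  intro he₀
  have hw := weight_apply hα hβ hγ
  have ht0 : ∀ x : t, (x : g) ∈ rootSpace t 0 := fun x =>
    hdecomp ▸ Submodule.mem_sup_left x.2
  have ht : ∀ x y : t, ⁅(x : g), (y : g)⁆ = 0 := fun x y => by simpa using ht0 y x
  obtain ⟨hα1, hα2, hα3⟩ := id hα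
  obtain ⟨hβ1, hβ2, hβ3⟩ := id hβ
  obtain ⟨hγ1, hγ2, hγ3⟩ := id hγ
  set Q := jointProj (LieAlgebra.ad F g (t₁ : g)) (LieAlgebra.ad F g (t₂ : g))
      (LieAlgebra.ad F g (t₃ : g))
  have hQmem : ∀ e v, Q e v ∈ rootSpace t (weight α β γ e) := fun e v =>
    jointProj_mem_rootSpace hp ht htor1 htor2 htor3 hspan hα hβ hγ e v
  have hQsum : ∀ v, ∑ e, Q e v = v := fun v => by
    simpa using LinearMap.congr_fun (sum_jointProj (LieAlgebra.ad F g (t₁ : g))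
      (LieAlgebra.ad F g (t₂ : g)) (LieAlgebra.ad F g (t₃ : g))) v
  have hQzero : ∀ {e v}, v ∈ rootSpace t (weight α β γ e) → Q 0 v = if e = 0 then v else 0 :=
    fun hv => jointProj_zero_of_mem t₁ t₂ t₃ hα hβ hγ hv
  have ht1ne : (t₁ : g) ≠ 0 := fun h => by
    rw [Subtype.ext (a1 := t₁) (a2 := 0) h] at hα1
    simp at hα1
  obtain ⟨f, hf0, hf⟩ := exists_annihilated_weight
    (fun e => rootSpace t (weight α β γ e) ≠ ⊥)
    (fun h => ht1ne <| by
      have := ht0 t₁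
      rw [weight_zero] at h
      rwa [h, Submodule.mem_bot] at this)
    (by
      intro s hs
      by_contra hcon
      push Not at hcon
      set c := ZMod.castHom (dvd_refl 2) F
      let x : t := c s.1 • t₁ + (c s.2.1 • t₂ + c s.2.2 • t₃)
      have hx : x = 0 := by
        refine Subtype.ext (central_eq_zero hdim1 hsimple fun y => ?_)
        rw [← hQsum y, sum_lie]
        refine Finset.sum_eq_zero fun e _ => ?_
        by_cases hb : rootSpace t (weight α β γ e) = ⊥
        · have := hQmem e y
          rw [hb, Submodule.mem_bot] at this
          rw [this, zero_lie]
        · rw [← lie_skew, hQmem e y x]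
          have : weight α β γ e x = c (e.1 * s.1 + e.2.1 * s.2.1 + e.2.2 * s.2.2) := by
            simp only [x, map_add, map_smul, map_mul, (hw e).1, (hw e).2.1, (hw e).2.2,
              smul_eq_mul]
            ring
          rw [this, hcon e hb, map_zero, zero_smul, neg_zero]
      refine hs (Prod.ext ((map_eq_zero c).1 ?_)
        (Prod.ext ((map_eq_zero c).1 ?_) ((map_eq_zero c).1 ?_)))
      · simpa [x, hα1, hα2, hα3] using congr_arg α hx
      · simpa [x, hβ1, hβ2, hβ3] using congr_arg β hx
      · simpa [x, hγ1, hγ2, hγ3] using congr_arg γ hx)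
    (not_not.2 he₀)
  obtain ⟨q, hnq, hq⟩ := hdisj.symm.exists_isCompl
  set P : g →ₗ[F] t := t.toSubmodule.projectionOnto q hq.symm
  have hPt : ∀ s : t, P s = s := fun s => Submodule.projectionOnto_apply_left hq.symm s
  have hPn : ∀ v ∈ n, P v = 0 := fun v hv =>
    Submodule.projectionOnto_apply_of_mem_right hq.symm (hnq hv)
  have hsplit : ∀ h ∈ rootSpace t 0, ∃ s : t, ∃ v ∈ n, h = s + v ∧ P h = s := by
    intro h hh
    rw [hdecomp] at hh
    obtain ⟨s, hs, v, hv, rfl⟩ := Submodule.mem_sup.1 hh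
    exact ⟨⟨s, hs⟩, v, hv, rfl, by rw [map_add, hPn v hv, add_zero]; exact hPt ⟨s, hs⟩⟩
  have hkill : ∀ h ∈ rootSpace t 0, ∀ m : Module.Dual F t, ∀ z ∈ rootSpace t m, z ≠ 0 →
      ⁅h, z⁆ = 0 → m (P h) = 0 := by
    intro h hh m z hz hz0 hhz
    obtain ⟨s, v, hv, rfl, hPh⟩ := hsplit h hh
    rw [hPh]
    exact hp.weight_eq_zero (hn v hv) hz hz0 hhz
  have hchar : ∀ l : ZMod 2 × ZMod 2 × ZMod 2, l + l = 0 := by decide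
  have hself0 : ∀ {l x y}, x ∈ rootSpace t (weight α β γ l) →
      y ∈ rootSpace t (weight α β γ l) → ⁅x, y⁆ ∈ rootSpace t 0 := by
    intro l x y hx hy
    have := lie_mem_rootSpace hx hy
    rwa [← weight_add, hchar, weight_zero] at this
  have hp0 : p 0 = 0 := by simpa using hp.smul_pow 0 0
  have hsq : ∀ l, ∀ x ∈ rootSpace t (weight α β γ l), weight α β γ l (P (p x)) = 0 := by
    intro l x hx
    rcases eq_or_ne x 0 with rfl | hx0
    · rw [hp0, map_zero, map_zero]
    · exact hkill _ (hp.mem_rootSpace_zero hx) _ x hx hx0 (by rw [hp.ad_pow, lie_self, lie_zero])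
  have hself : ∀ l, ∀ x ∈ rootSpace t (weight α β γ l), ∀ y ∈ rootSpace t (weight α β γ l),
      weight α β γ l (P ⁅x, y⁆) = 0 := by
    intro l x hx y hy
    have h := hsq l _ (Submodule.add_mem _ hx hy)
    rwa [hp.add_pow, map_add, map_add, map_add, map_add, hsq l x hx, hsq l y hy, zero_add,
      zero_add] at h
  have hmiss : ∀ l m, rootSpace t (weight α β γ m) ≠ ⊥ →
      rootSpace t (weight α β γ (l + m)) = ⊥ → ∀ x ∈ rootSpace t (weight α β γ l),
      ∀ y ∈ rootSpace t (weight α β γ l), weight α β γ m (P ⁅x, y⁆) = 0 := by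
    intro l m hm hlm x hx y hy
    obtain ⟨z, hz, hz0⟩ := Submodule.exists_mem_ne_zero_of_ne_bot hm
    have hbr : ∀ u ∈ rootSpace t (weight α β γ l), ⁅u, z⁆ = 0 := by
      intro u hu
      have := lie_mem_rootSpace hu hz
      rwa [← weight_add, hlm, Submodule.mem_bot] at this
    refine hkill _ (hself0 hx hy) _ z hz hz0 ?_
    rw [lie_lie, hbr y hy, hbr x hx, lie_zero, lie_zero, sub_zero]
  have hvanish : ∀ l, l ≠ 0 → ∀ x ∈ rootSpace t (weight α β γ l),
      ∀ y ∈ rootSpace t (weight α β γ l), weight α β γ f (P ⁅x, y⁆) = 0 := by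
    intro l hl x hx y hy
    by_cases hb : rootSpace t (weight α β γ l) = ⊥
    · rw [hb, Submodule.mem_bot] at hx
      rw [hx, zero_lie, map_zero, map_zero]
    · have hgood : ∀ m, (rootSpace t (weight α β γ m) ≠ ⊥ ∧
          (l = m ∨ ¬rootSpace t (weight α β γ (l + m)) ≠ ⊥)) →
          weight α β γ m (P ⁅x, y⁆) = 0 := by
        rintro m ⟨hm, rfl | hlm⟩
        · exact hself _ x hx y hy
        · exact hmiss l m hm (not_not.1 hlm) x hx y hy
      obtain ⟨a, b, ha, hb, rfl⟩ := hf l hl hb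
      rw [weight_add, LinearMap.add_apply, hgood a ha, zero_add]
      rcases hb with rfl | hb
      · rw [weight_zero, LinearMap.zero_apply]
      · exact hgood b hb
  have hn0 : ∀ x ∈ rootSpace t 0, ∀ y ∈ rootSpace t 0, P ⁅x, y⁆ = 0 := by
    intro x hx y hy
    obtain ⟨s, v, hv, rfl, -⟩ := hsplit y hy
    have hxs : ⁅x, (s : g)⁆ = 0 := by rw [← lie_skew, hx s]; simp
    rw [lie_add, hxs, zero_add]
    exact hPn _ (hstd x hx v hv)
  let φ : g →ₗ[F] F := weight α β γ f ∘ₗ P ∘ₗ Q 0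
  have hφ : ∀ x y : g, φ ⁅x, y⁆ = 0 := by
    intro x y
    rw [← hQsum x, ← hQsum y, sum_lie, map_sum]
    refine Finset.sum_eq_zero fun a _ => ?_
    rw [lie_sum, map_sum]
    refine Finset.sum_eq_zero fun b _ => ?_
    have hab := lie_mem_rootSpace (hQmem a x) (hQmem b y)
    rw [← weight_add] at hab
    change weight α β γ f (P (Q 0 _)) = 0
    rw [hQzero hab]
    split_ifs with h
    · obtain rfl : b = a := by rw [← add_zero b, ← hchar a, ← add_assoc, add_comm b, h, zero_add]
      rcases eq_or_ne b 0 with rfl | hb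
      · have hx := hQmem 0 x
        have hy := hQmem 0 y
        rw [weight_zero] at hx hy
        rw [hn0 _ hx _ hy, map_zero]
      · exact hvanish b hb _ (hQmem b x) _ (hQmem b y)
    · rw [map_zero, map_zero]
  refine weight_ne_zero hα hβ hγ hf0 (LinearMap.ext fun s => ?_)
  have hs : Q 0 (s : g) = s := by
    have hs0 := ht0 s
    rw [← weight_zero α β γ] at hs0
    rw [hQzero hs0, if_pos rfl]
  have := linearMap_eq_zero_of_lie hdim1 hsimple φ hφ s
  simpa [φ, hs, hPt] using this

end Weights

/-- a simple Lie 2-algebra of toral rank 3 with a standard (triangulable)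
maximal torus has all seven nonzero elements of `t*` as roots. -/
theorem statement17
    {F : Type*} [Field F] [IsAlgClosed F] [CharP F 2]
    {g : Type*} [LieRing g] [LieAlgebra F g] [FiniteDimensional F g]
    (p : g → g) (hp : IsTwoMap F p)
    (hdim1 : Module.finrank F g ≠ 1)
    (hsimple : ∀ I : LieIdeal F g, I = ⊥ ∨ I = ⊤)
    (t : LieSubalgebra F g) (hmax : IsMaxTorus F p t)
    (n : Submodule F g)
    (hn : ∀ x : g, x ∈ n ↔ x ∈ rootSpace t 0 ∧ IsTwoNilpotent p x)
    (hstd : ∀ x ∈ rootSpace t 0, ∀ y ∈ n, ⁅x, y⁆ ∈ n)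
    (hdecomp : rootSpace t 0 = t.toSubmodule ⊔ n)
    (hdisj : Disjoint t.toSubmodule n)
    (hrank : ∀ s : LieSubalgebra F g, IsTorus F p s → Module.finrank F s ≤ 3)
    (hdimt : Module.finrank F t = 3)
    (t₁ t₂ t₃ : t)
    (htor1 : p (t₁ : g) = (t₁ : g)) (htor2 : p (t₂ : g) = (t₂ : g))
    (htor3 : p (t₃ : g) = (t₃ : g))
    (hspan : Submodule.span F ({t₁, t₂, t₃} : Set t) = ⊤)
    (α β γ : Module.Dual F t)
    (hα : α t₁ = 1 ∧ α t₂ = 0 ∧ α t₃ = 0)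
    (hβ : β t₁ = 0 ∧ β t₂ = 1 ∧ β t₃ = 0)
    (hγ : γ t₁ = 0 ∧ γ t₂ = 0 ∧ γ t₃ = 1)
    : rootSet t = ({α, β, γ, α + β, α + γ, β + γ, α + β + γ} :
        Set (Module.Dual F t)) := by
  have hall := rootSpace_weight_ne_bot hp hdim1 hsimple (fun x hx => ((hn x).1 hx).2) hstd
    hdecomp hdisj htor1 htor2 htor3 hspan hα hβ hγ
  have hroot : ∀ e, e ≠ 0 → weight α β γ e ∈ rootSet t := fun e he =>
    ⟨weight_ne_zero hα hβ hγ he, hall e⟩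
  have hw := weight_apply hα hβ hγ
  ext lam
  simp only [Set.mem_insert_iff, Set.mem_singleton_iff]
  constructor
  · rintro ⟨h0, hlam⟩
    obtain ⟨c₁, hc₁⟩ := hp.exists_zmod_eq htor1 hlam
    obtain ⟨c₂, hc₂⟩ := hp.exists_zmod_eq htor2 hlam
    obtain ⟨c₃, hc₃⟩ := hp.exists_zmod_eq htor3 hlam
    have hlam' : lam = weight α β γ (c₁, c₂, c₃) :=
      dual_ext_of_span hspan (hc₁.trans (hw (c₁, c₂, c₃)).1.symm)
        (hc₂.trans (hw (c₁, c₂, c₃)).2.1.symm) (hc₃.trans (hw (c₁, c₂, c₃)).2.2.symm)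
    have h01 : ∀ a : ZMod 2, a = 0 ∨ a = 1 := by decide
    rcases h01 c₁ with rfl | rfl <;> rcases h01 c₂ with rfl | rfl <;>
      rcases h01 c₃ with rfl | rfl <;>
      simp only [weight, map_zero, map_one, zero_smul, one_smul, zero_add, add_zero] at hlam' <;>
      first
      | exact absurd hlam' h0
      | rw [hlam']; simp [add_assoc]
  · rintro (rfl | rfl | rfl | rfl | rfl | rfl | rfl)
    · simpa [weight] using hroot (1, 0, 0) (by decide)
    · simpa [weight] using hroot (0, 1, 0) (by decide)
    · simpa [weight] using hroot (0, 0, 1) (by decide)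
    · simpa [weight] using hroot (1, 1, 0) (by decide)
    · simpa [weight] using hroot (1, 0, 1) (by decide)
    · simpa [weight] using hroot (0, 1, 1) (by decide)
    · simpa [weight, add_assoc] using hroot (1, 1, 1) (by decide)
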